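/- Let σ and ρ be states on ℂ^d with ρ positive definite, and let M = (M_1, …, M_m) be any POVM on ℂ^d. Then D_M(σ ‖ ρ) ≤ D(σ ‖ ρ). -/

import Mathlib

open Matrix Filter ComplexOrder

section Defs

variable {ι : Type*} [Fintype ι] [DecidableEq ι]

/-- Functional calculus for Hermitian matrices: apply `f` to the eigenvalues. -/
noncomputable def matCFC (f : ℝ → ℝ) (A : Matrix ι ι ℂ) : Matrix ι ι ℂ :=
  if hA : A.IsHermitian then
    (hA.eigenvectorUnitary : Matrix ι ι ℂ) *
      Matrix.diagonal (fun i => (f (hA.eigenvalues i) : ℂ)) *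
      star (hA.eigenvectorUnitary : Matrix ι ι ℂ)
  else 0

/-- Matrix logarithm by functional calculus (with the convention `log 0 = 0`,
so that `0 log 0 = 0`). -/
noncomputable def matLog (A : Matrix ι ι ℂ) : Matrix ι ι ℂ := matCFC Real.log A

/-- A state (density matrix): positive semidefinite with trace one. -/
def IsState (ρ : Matrix ι ι ℂ) : Prop := ρ.PosSemidef ∧ ρ.trace = 1

/-- Quantum relative entropy `D(σ‖ρ) = Tr[σ (log σ - log ρ)]`. -/
noncomputable def qRelEnt (σ ρ : Matrix ι ι ℂ) : ℝ :=
  (σ * (matLog σ - matLog ρ)).trace.re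

/-- A POVM: finitely many positive semidefinite matrices summing to the identity. -/
def IsPOVM {J : Type*} [Fintype J] (M : J → Matrix ι ι ℂ) : Prop :=
  (∀ j, (M j).PosSemidef) ∧ ∑ j, M j = 1

/-- A PVM: a POVM consisting of mutually orthogonal projections. -/
def IsPVM {J : Type*} [Fintype J] (M : J → Matrix ι ι ℂ) : Prop :=
  IsPOVM M ∧ (∀ j, (M j).IsHermitian ∧ M j * M j = M j) ∧
    ∀ j j', j ≠ j' → M j * M j' = 0

/-- Kullback–Leibler divergence of finite probability vectors
(with the convention `0 log 0 = 0`, using `Real.log 0 = 0`). -/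
noncomputable def klDiv {J : Type*} [Fintype J] (p q : J → ℝ) : ℝ :=
  ∑ j, p j * Real.log (p j / q j)

/-- The outcome probability `Tr[M ρ]` of a POVM element `M` in the state `ρ`. -/
noncomputable def probOf (M ρ : Matrix ι ι ℂ) : ℝ := (M * ρ).trace.re

/-- `D_M(σ‖ρ)`: the KL divergence of the outcome distributions of a POVM `M`. -/
noncomputable def Dm {J : Type*} [Fintype J] (M : J → Matrix ι ι ℂ)
    (σ ρ : Matrix ι ι ℂ) : ℝ :=
  klDiv (fun j => probOf (M j) σ) (fun j => probOf (M j) ρ)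

/-- A PVM `F` refines a family `E` if every member of `E` is a sum of some members of `F`. -/
def Refines {J K : Type*} [Fintype J] (F : J → Matrix ι ι ℂ) (E : K → Matrix ι ι ℂ) : Prop :=
  ∀ i, ∃ S : Finset J, E i = ∑ j ∈ S, F j

/-- The set of eigenvalues of a Hermitian matrix, as a finite set of reals. -/
noncomputable def spectrumFinset (A : Matrix ι ι ℂ) : Finset ℝ :=
  letI := Classical.decEq ℝ
  if hA : A.IsHermitian then Finset.image hA.eigenvalues Finset.univ else ∅

/-- The eigenprojection of a Hermitian matrix `A` for the eigenvalue `c`. -/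
noncomputable def eigProj (A : Matrix ι ι ℂ) (c : ℝ) : Matrix ι ι ℂ :=
  letI := Classical.decEq ℝ
  matCFC (fun x => if x = c then 1 else 0) A

/-- `F` refines the spectral PVM `E(ρ)` of `ρ`: every eigenprojection of `ρ`
is a sum of some members of `F`. -/
def RefinesSpectral {J : Type*} [Fintype J] (F : J → Matrix ι ι ℂ)
    (ρ : Matrix ι ι ℂ) : Prop :=
  ∀ c ∈ spectrumFinset ρ, ∃ S : Finset J, eigProj ρ c = ∑ j ∈ S, F j

/-- The pinching (conditional expectation) `𝓔_F(σ) = Σ_j F_j σ F_j` of `σ` by a PVM `F`. -/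
noncomputable def pinchPVM {J : Type*} [Fintype J] (F : J → Matrix ι ι ℂ)
    (σ : Matrix ι ι ℂ) : Matrix ι ι ℂ :=
  ∑ j, F j * σ * F j

/-- The pinching `𝓔_τ(σ)` of `σ` by the spectral PVM of `τ`. -/
noncomputable def spectralPinch (τ σ : Matrix ι ι ℂ) : Matrix ι ι ℂ :=
  ∑ c ∈ spectrumFinset τ, eigProj τ c * σ * eigProj τ c

/-- The support of a matrix, i.e. the range of the associated linear map. -/
noncomputable def matSupp (A : Matrix ι ι ℂ) : Submodule ℂ (ι → ℂ) := LinearMap.range A.mulVecLin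

end Defs

/-- The `n`-fold tensor (Kronecker) power `A^{⊗n}` of a `k × k` matrix,
acting on `(ℂ^k)^{⊗n}`. -/
noncomputable def tensPow {k : ℕ} (n : ℕ) (A : Matrix (Fin k) (Fin k) ℂ) :
    Matrix (Fin n → Fin k) (Fin n → Fin k) ℂ :=
  Matrix.of fun x y => ∏ i, A (x i) (y i)


section Aux
variable {ι : Type*} [Fintype ι] [DecidableEq ι]

lemma aux_integrable {s r : ℝ} (hs : 0 ≤ s) (hr : 0 < r) :
    IntervalIntegrable (fun t => (1-t)*(s-r)^2/((1-t)*r+t*s)) MeasureTheory.volume 0 1 ∧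
    ∫ t in (0:ℝ)..1, (1-t)*(s-r)^2/((1-t)*r+t*s) = s * Real.log (s/r) - s + r := by
  rcases hs.eq_or_lt with rfl | hs
  · have h : Set.EqOn (fun _ : ℝ => r) (fun t => (1-t)*(0-r)^2/((1-t)*r+t*0)) (Set.Ioo 0 1) := by
      intro t ht
      have : (1 - t) ≠ 0 := by have := ht.2; linarith
      field_simp
      simp
      ring
    constructor
    · rw [intervalIntegrable_iff_integrableOn_Ioo_of_le zero_le_one]
      refine MeasureTheory.IntegrableOn.congr_fun ?_ h measurableSet_Ioo
      simp
    · rw [intervalIntegral.integral_of_le zero_le_one, MeasureTheory.integral_Ioc_eq_integral_Ioo,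
        ← MeasureTheory.setIntegral_congr_fun measurableSet_Ioo h]
      simp
  · have hpos : ∀ t ∈ Set.uIcc (0:ℝ) 1, 0 < (1-t)*r+t*s := by
      intro t ht
      rw [Set.uIcc_of_le zero_le_one] at ht
      obtain ⟨h0, h1⟩ := ht
      rcases h0.eq_or_lt with rfl | h0
      · simpa using hr
      · have := mul_pos h0 hs
        have := mul_nonneg (sub_nonneg.2 h1) hr.le
        linarith
    have hi : IntervalIntegrable (fun t => (1-t)*(s-r)^2/((1-t)*r+t*s))
        MeasureTheory.volume 0 1 := by
      apply ContinuousOn.intervalIntegrable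
      refine ContinuousOn.div (by fun_prop) (by fun_prop) fun t ht => (hpos t ht).ne'
    refine ⟨hi, ?_⟩
    rw [intervalIntegral.integral_eq_sub_of_hasDerivAt
      (f := fun t => s * Real.log ((1-t)*r+t*s) - ((1-t)*r+t*s)) ?_ hi]
    · simp only [sub_self, zero_mul, one_mul, zero_add, sub_zero, add_zero]
      rw [Real.log_div hs.ne' hr.ne']; ring
    · intro t ht
      have hp := hpos t ht
      have h1 : HasDerivAt (fun t : ℝ => (1-t)*r+t*s) (s - r) t := by
        have := (((hasDerivAt_id t).const_sub 1).mul_const r).add ((hasDerivAt_id t).mul_const s)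
        refine this.congr_deriv ?_
        ring
      have := ((h1.log hp.ne').const_mul s).sub h1
      refine this.congr_deriv ?_
      have hne := hp.ne'
      rw [mul_div_assoc', eq_div_iff hne, sub_mul, div_mul_cancel₀ _ hne]
      ring

lemma aux_cfc_id {A : Matrix ι ι ℂ} (hA : A.IsHermitian) : matCFC (fun x => x) A = A := by
  rw [matCFC, dif_pos hA]
  conv_rhs => rw [hA.spectral_theorem]
  simp [Unitary.conjStarAlgAut_apply]
  rfl

lemma aux_cfc_one {A : Matrix ι ι ℂ} (hA : A.IsHermitian) : matCFC (fun _ => 1) A = 1 := by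
  rw [matCFC, dif_pos hA]
  simp

lemma aux_cfc_mul {A : Matrix ι ι ℂ} (hA : A.IsHermitian) (f g : ℝ → ℝ) :
    matCFC f A * matCFC g A = matCFC (fun x => f x * g x) A := by
  simp only [matCFC, dif_pos hA]
  have h : star (hA.eigenvectorUnitary : Matrix ι ι ℂ) * (hA.eigenvectorUnitary : Matrix ι ι ℂ) = 1 := by
    simp
  have : ∀ U D E W : Matrix ι ι ℂ, W * U = 1 → U * D * W * (U * E * W) = U * (D * E) * W := by
    intro U D E W h
    calc U * D * W * (U * E * W) = U * D * (W * U) * E * W := by simp only [mul_assoc]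
      _ = _ := by rw [h]; simp only [mul_assoc, mul_one]
  rw [this _ _ _ _ h, Matrix.diagonal_mul_diagonal]
  simp

/-- Matrix coefficients in the two eigenbases. -/
noncomputable def auxCoef {σ ρ : Matrix ι ι ℂ} (hσ : σ.IsHermitian) (hρ : ρ.IsHermitian)
    (X : Matrix ι ι ℂ) : Matrix ι ι ℂ :=
  star (hσ.eigenvectorUnitary : Matrix ι ι ℂ) * X * (hρ.eigenvectorUnitary : Matrix ι ι ℂ)

lemma aux_trace {σ ρ : Matrix ι ι ℂ} (hσ : σ.IsHermitian) (hρ : ρ.IsHermitian)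
    (X Y : Matrix ι ι ℂ) (f g : ℝ → ℝ) :
    (matCFC f σ * X * matCFC g ρ * Yᴴ).trace.re =
      ∑ i, ∑ k, f (hσ.eigenvalues i) * g (hρ.eigenvalues k) *
        (auxCoef hσ hρ X i k * star (auxCoef hσ hρ Y i k)).re := by
  have h1 : (matCFC f σ * X * matCFC g ρ * Yᴴ).trace =
      (Matrix.diagonal (fun i => (f (hσ.eigenvalues i) : ℂ)) * auxCoef hσ hρ X *
       (Matrix.diagonal (fun i => (g (hρ.eigenvalues i) : ℂ)) * (auxCoef hσ hρ Y)ᴴ)).trace := by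
    simp only [matCFC, dif_pos hσ, dif_pos hρ, auxCoef, star_eq_conjTranspose,
      conjTranspose_mul, conjTranspose_conjTranspose, mul_assoc]
    rw [Matrix.trace_mul_comm]
    simp only [mul_assoc]
  rw [h1, Matrix.trace, Complex.re_sum]
  refine Finset.sum_congr rfl fun i _ => ?_
  rw [Matrix.diag_apply, Matrix.mul_apply, Complex.re_sum]
  refine Finset.sum_congr rfl fun k _ => ?_
  rw [Matrix.diagonal_mul, Matrix.diagonal_mul, conjTranspose_apply]
  rw [← Complex.re_ofReal_mul]
  push_cast
  congr 1; ring

lemma aux_scalar (a w : ℝ) (hw : 0 < w) (c y : ℂ) :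
    2 * (a * (y * star c).re) - w * (y * star y).re ≤ a^2 / w * (c * star c).re := by
  have : a^2 / w * (c * star c).re - (2 * (a * (y * star c).re) - w * (y * star y).re)
    = ((a * c.re - w * y.re)^2 + (a * c.im - w * y.im)^2) / w := by
    simp only [Complex.mul_re, Complex.star_def, Complex.conj_re, Complex.conj_im]
    field_simp
    ring
  have h2 : 0 ≤ ((a * c.re - w * y.re)^2 + (a * c.im - w * y.im)^2) / w := by positivity
  linarith

lemma aux_tr_nonneg {A B : Matrix ι ι ℂ} (hA : A.PosSemidef) (hB : B.PosSemidef) :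
    0 ≤ (A * B).trace.re := by
  obtain ⟨C, rfl⟩ : ∃ C : Matrix ι ι ℂ, B = Cᴴ * C := by
    open scoped MatrixOrder in
    exact CStarAlgebra.nonneg_iff_eq_star_mul_self.1 hB.nonneg
  rw [← mul_assoc, Matrix.trace_mul_comm, ← mul_assoc]
  have := (hA.mul_mul_conjTranspose_same C).trace_nonneg
  exact (Complex.le_def.1 this).1

lemma aux_kadison {m : ℕ} (M : Fin m → Matrix ι ι ℂ) (hM : IsPOVM M) (y : Fin m → ℝ)
    {τ : Matrix ι ι ℂ} (hτ : τ.PosSemidef) :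
    (τ * ((∑ j, (y j : ℂ) • M j) * (∑ j, (y j : ℂ) • M j))).trace.re ≤
      ∑ j, y j ^ 2 * probOf (M j) τ := by
  set Y := ∑ j, (y j : ℂ) • M j with hY
  have hYh : Yᴴ = Y := by
    rw [hY, conjTranspose_sum]
    refine Finset.sum_congr rfl fun j _ => ?_
    rw [conjTranspose_smul, (hM.1 j).1.eq]
    simp
  have hps : (∑ j, (((y j : ℂ) • (1 : Matrix ι ι ℂ) - Y)ᴴ * M j * ((y j : ℂ) • 1 - Y))).PosSemidef :=
    Matrix.posSemidef_sum _ fun j _ => (hM.1 j).conjTranspose_mul_mul_same _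
  have heq : (∑ j, (((y j : ℂ) • (1 : Matrix ι ι ℂ) - Y)ᴴ * M j * ((y j : ℂ) • 1 - Y)))
      = ∑ j, ((y j ^ 2 : ℝ) : ℂ) • M j - Y * Y := by
    have : ∀ j, (((y j : ℂ) • (1 : Matrix ι ι ℂ) - Y)ᴴ * M j * ((y j : ℂ) • 1 - Y))
      = ((y j ^ 2 : ℝ) : ℂ) • M j - ((y j : ℂ) • M j) * Y - Y * ((y j : ℂ) • M j)
        + Y * M j * Y := by
      intro j
      rw [conjTranspose_sub, hYh, conjTranspose_smul]
      simp only [conjTranspose_one, Complex.star_def, Complex.conj_ofReal, sub_mul, mul_sub,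
        Matrix.smul_mul, Matrix.mul_smul, one_mul, mul_one, smul_sub, smul_smul, pow_two,
        Complex.ofReal_mul]
      abel
    simp only [this, Finset.sum_add_distrib, Finset.sum_sub_distrib, ← Finset.sum_mul,
      ← Finset.mul_sum, hM.2, ← hY]
    simp
  rw [heq] at hps
  have := aux_tr_nonneg hτ hps
  rw [mul_sub, trace_sub, Complex.sub_re, Finset.mul_sum, trace_sum, Complex.re_sum] at this
  have h3 : ∀ j, (τ * ((y j ^ 2 : ℝ) : ℂ) • M j).trace.re = y j ^ 2 * probOf (M j) τ := by
    intro j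
    rw [Matrix.mul_smul, trace_smul, smul_eq_mul, Complex.re_ofReal_mul, probOf, trace_mul_comm]
  simp only [h3] at this
  linarith

lemma aux_key {m : ℕ} {σ ρ : Matrix ι ι ℂ} (hσ : σ.PosSemidef) (hρ : ρ.PosDef)
    (M : Fin m → Matrix ι ι ℂ) (hM : IsPOVM M) {t : ℝ} (h0 : 0 < t) (h1 : t < 1) :
    ∑ j, (probOf (M j) σ - probOf (M j) ρ)^2/((1-t)*probOf (M j) ρ + t * probOf (M j) σ) ≤
    ∑ i, ∑ k, (hσ.1.eigenvalues i - hρ.1.eigenvalues k)^2 /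
      ((1-t)*hρ.1.eigenvalues k + t * hσ.1.eigenvalues i) *
      (auxCoef hσ.1 hρ.1 1 i k * star (auxCoef hσ.1 hρ.1 1 i k)).re := by
  set p := fun j => probOf (M j) σ
  set q := fun j => probOf (M j) ρ
  set y : Fin m → ℝ := fun j => (p j - q j) / ((1-t)*q j + t * p j) with hy
  have hp : ∀ j, 0 ≤ p j := fun j => aux_tr_nonneg (hM.1 j) hσ
  have hq : ∀ j, 0 ≤ q j := fun j => aux_tr_nonneg (hM.1 j) hρ.posSemidef
  set Y := ∑ j, (y j : ℂ) • M j with hY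
  have hYh : Yᴴ = Y := by
    rw [hY, conjTranspose_sum]
    refine Finset.sum_congr rfl fun j _ => ?_
    rw [conjTranspose_smul, (hM.1 j).1.eq]
    simp
  have hk1 := aux_kadison M hM y hσ
  have hk2 := aux_kadison M hM y hρ.posSemidef
  rw [← hY] at hk1 hk2
  have e1 : (σ * (Y * Y)).trace.re = ∑ i, ∑ k, hσ.1.eigenvalues i *
      (auxCoef hσ.1 hρ.1 Y i k * star (auxCoef hσ.1 hρ.1 Y i k)).re := by
    have := aux_trace hσ.1 hρ.1 Y Y (fun x => x) (fun _ => 1)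
    rw [aux_cfc_id, aux_cfc_one, hYh] at this
    · simpa [mul_assoc] using this
    · exact hρ.1
    · exact hσ.1
  have e2 : (ρ * (Y * Y)).trace.re = ∑ i, ∑ k, hρ.1.eigenvalues k *
      (auxCoef hσ.1 hρ.1 Y i k * star (auxCoef hσ.1 hρ.1 Y i k)).re := by
    have := aux_trace hσ.1 hρ.1 Y Y (fun _ => 1) (fun x => x)
    rw [aux_cfc_id hρ.1, aux_cfc_one hσ.1, hYh, one_mul, mul_assoc, trace_mul_comm, mul_assoc] at this
    simpa using this
  have e3 : (Y * σ).trace.re = ∑ i, ∑ k, hσ.1.eigenvalues i *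
      (auxCoef hσ.1 hρ.1 Y i k * star (auxCoef hσ.1 hρ.1 1 i k)).re := by
    have := aux_trace hσ.1 hρ.1 Y 1 (fun x => x) (fun _ => 1)
    rw [aux_cfc_id hσ.1, aux_cfc_one hρ.1, conjTranspose_one, mul_one, mul_one,
      trace_mul_comm] at this
    simpa using this
  have e4 : (Y * ρ).trace.re = ∑ i, ∑ k, hρ.1.eigenvalues k *
      (auxCoef hσ.1 hρ.1 Y i k * star (auxCoef hσ.1 hρ.1 1 i k)).re := by
    have := aux_trace hσ.1 hρ.1 Y 1 (fun _ => 1) (fun x => x)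
    rw [aux_cfc_id hρ.1, aux_cfc_one hσ.1, conjTranspose_one, mul_one, one_mul] at this
    simpa using this
  have e5 : ∀ τ : Matrix ι ι ℂ, (Y * τ).trace.re = ∑ j, y j * probOf (M j) τ := by
    intro τ
    rw [hY, Finset.sum_mul, trace_sum, Complex.re_sum]
    refine Finset.sum_congr rfl fun j _ => ?_
    rw [Matrix.smul_mul, trace_smul, smul_eq_mul, Complex.re_ofReal_mul, probOf]
  have hR : 2 * ((Y * σ).trace.re - (Y * ρ).trace.re)
      - ((1-t) * (ρ * (Y * Y)).trace.re + t * (σ * (Y * Y)).trace.re) ≤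
      ∑ i, ∑ k, (hσ.1.eigenvalues i - hρ.1.eigenvalues k)^2 /
      ((1-t)*hρ.1.eigenvalues k + t * hσ.1.eigenvalues i) *
      (auxCoef hσ.1 hρ.1 1 i k * star (auxCoef hσ.1 hρ.1 1 i k)).re := by
    rw [e1, e2, e3, e4]
    simp only [Finset.mul_sum, ← Finset.sum_sub_distrib, ← Finset.sum_add_distrib]
    refine Finset.sum_le_sum fun i _ => Finset.sum_le_sum fun k _ => ?_
    have hw : 0 < (1-t)*hρ.1.eigenvalues k + t * hσ.1.eigenvalues i := by
      have a1 := mul_pos (sub_pos.2 h1) (hρ.eigenvalues_pos k)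
      have a2 := mul_nonneg h0.le (hσ.eigenvalues_nonneg i)
      linarith
    refine le_trans (le_of_eq ?_) (aux_scalar _ _ hw _ (auxCoef hσ.1 hρ.1 Y i k))
    ring
  refine le_trans ?_ hR
  have hL : ∑ j, (p j - q j)^2/((1-t)*q j + t * p j) =
      2 * (∑ j, y j * p j - ∑ j, y j * q j)
       - ((1-t) * ∑ j, y j ^ 2 * q j + t * ∑ j, y j ^ 2 * p j) := by
    simp only [Finset.mul_sum, ← Finset.sum_sub_distrib, ← Finset.sum_add_distrib]
    refine Finset.sum_congr rfl fun j _ => ?_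
    simp only [hy]
    by_cases hw : (1-t)*q j + t * p j = 0
    · simp [hw]
    · field_simp
      ring
  rw [hL, e5, e5]
  have a1 := mul_le_mul_of_nonneg_left hk1 h0.le
  have a2 := mul_le_mul_of_nonneg_left hk2 (sub_pos.2 h1).le
  simp only [p, q] at *
  linarith

end Aux

/-- monotonicity / Uhlmann's inequality: For states `σ, ρ` with `ρ`
positive definite and any POVM `M`, `D_M(σ‖ρ) ≤ D(σ‖ρ)`. -/
theorem statement5 (d m : ℕ) (σ ρ : Matrix (Fin d) (Fin d) ℂ)
    (hσ : IsState σ) (hρ : IsState ρ) (hρpd : ρ.PosDef)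
    (M : Fin m → Matrix (Fin d) (Fin d) ℂ) (hM : IsPOVM M) :
    Dm M σ ρ ≤ qRelEnt σ ρ := by
  obtain ⟨hσp, hσt⟩ := hσ
  obtain ⟨-, hρt⟩ := hρ
  set p := fun j => probOf (M j) σ with hpdef
  set q := fun j => probOf (M j) ρ with hqdef
  have hp : ∀ j, 0 ≤ p j := fun j => aux_tr_nonneg (hM.1 j) hσp
  have hq : ∀ j, 0 ≤ q j := fun j => aux_tr_nonneg (hM.1 j) hρpd.posSemidef
  have hsum : ∀ τ : Matrix (Fin d) (Fin d) ℂ, τ.trace = 1 → ∑ j, probOf (M j) τ = 1 := by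
    intro τ h
    simp only [probOf]
    rw [← Complex.re_sum, ← trace_sum, ← Finset.sum_mul, hM.2, one_mul, h, Complex.one_re]
  have hq0 : ∀ j, q j = 0 → p j = 0 := by
    intro j hj
    have : M j = 0 := by
      obtain ⟨C, hC⟩ : ∃ C : Matrix (Fin d) (Fin d) ℂ, M j = Cᴴ * C := by
        open scoped MatrixOrder in
        exact CStarAlgebra.nonneg_iff_eq_star_mul_self.1 (hM.1 j).nonneg
      have hz : (C * ρ * Cᴴ).trace = 0 := by
        have h1 := (hρpd.posSemidef.mul_mul_conjTranspose_same C).trace_nonneg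
        have h2 : (C * ρ * Cᴴ).trace.re = 0 := by
          rw [trace_mul_comm, ← mul_assoc, ← hC]; exact hj
        exact Complex.ext h2 (Complex.le_def.1 h1).2.symm
      have h3 := (hρpd.posSemidef.mul_mul_conjTranspose_same C).trace_eq_zero_iff.1 hz
      have h4 : C = 0 := by
        ext i k
        have h5 := hρpd.dotProduct_mulVec_pos (x := star (C i))
        by_contra hne
        have h6 := h5 (fun h => hne (by
          have := congrFun h k
          simpa using this))
        have h7 := congrFun (congrFun h3 i) i
        have h8 : (C * ρ * Cᴴ) i i = star (star (C i)) ⬝ᵥ ρ *ᵥ star (C i) := by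
          rw [star_star, mul_assoc]
          rfl
        rw [← h8, h7] at h6
        simp at h6
      rw [hC, h4]; simp
    simp [hpdef, probOf, this]
  set s := hσp.1.eigenvalues
  set r := hρpd.1.eigenvalues
  set c := fun i k => (auxCoef hσp.1 hρpd.1 1 i k * star (auxCoef hσp.1 hρpd.1 1 i k)).re with hc
  have hs : ∀ i, 0 ≤ s i := hσp.eigenvalues_nonneg
  have hr : ∀ i, 0 < r i := hρpd.eigenvalues_pos
  have htr : ∀ f g : ℝ → ℝ, (matCFC f σ * matCFC g ρ).trace.re =
      ∑ i, ∑ k, f (s i) * g (r k) * c i k := by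
    intro f g
    have := aux_trace hσp.1 hρpd.1 1 1 f g
    rwa [mul_one, conjTranspose_one, mul_one] at this
  -- the quantum side as an integral
  have hQ : qRelEnt σ ρ = ∑ i, ∑ k, (s i * Real.log (s i / r k) - s i + r k) * c i k := by
    have e1 : (σ * matLog σ).trace.re = ∑ i, ∑ k, (s i * Real.log (s i)) * 1 * c i k := by
      rw [← htr (fun x => x * Real.log x) (fun _ => 1), aux_cfc_one hρpd.1, mul_one,
        ← aux_cfc_mul hσp.1, aux_cfc_id hσp.1]
      rfl
    have e2 : (σ * matLog ρ).trace.re = ∑ i, ∑ k, s i * Real.log (r k) * c i k := by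
      rw [← htr (fun x => x) Real.log, aux_cfc_id hσp.1]
      rfl
    have e3 : 1 = ∑ i, ∑ k, s i * 1 * c i k := by
      rw [← htr (fun x => x) (fun _ => 1), aux_cfc_id hσp.1, aux_cfc_one hρpd.1, mul_one, hσt]
      simp
    have e4 : 1 = ∑ i, ∑ k, 1 * r k * c i k := by
      rw [← htr (fun _ => 1) (fun x => x), aux_cfc_id hρpd.1, aux_cfc_one hσp.1, one_mul, hρt]
      simp
    have : qRelEnt σ ρ = ∑ i, ∑ k, (s i * Real.log (s i)) * 1 * c i k
        - ∑ i, ∑ k, s i * Real.log (r k) * c i k - ∑ i, ∑ k, s i * 1 * c i k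
        + ∑ i, ∑ k, 1 * r k * c i k := by
      rw [← e1, ← e2, ← e3, ← e4, qRelEnt, mul_sub, trace_sub, Complex.sub_re]; ring
    rw [this]
    simp only [← Finset.sum_sub_distrib, ← Finset.sum_add_distrib]
    refine Finset.sum_congr rfl fun i _ => Finset.sum_congr rfl fun k _ => ?_
    rcases (hs i).eq_or_lt with h | h
    · rw [← h]; ring
    · rw [Real.log_div h.ne' (hr k).ne']; ring
  have hD : Dm M σ ρ = ∑ j, (p j * Real.log (p j / q j) - p j + q j) := by
    rw [Finset.sum_add_distrib, Finset.sum_sub_distrib, hsum σ hσt, hsum ρ hρt]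
    simp [Dm, klDiv, p, q]
  have hint : ∀ j, IntervalIntegrable
      (fun t => (1-t)*(p j-q j)^2/((1-t)*q j+t*p j)) MeasureTheory.volume 0 1 ∧
      ∫ t in (0:ℝ)..1, (1-t)*(p j-q j)^2/((1-t)*q j+t*p j)
        = p j * Real.log (p j/q j) - p j + q j := by
    intro j
    rcases (hq j).eq_or_lt with h | h
    · rw [← h, hq0 j h.symm]; simp
    · exact aux_integrable (hp j) h
  have hint2 := fun i k => aux_integrable (hs i) (hr k)
  rw [hD, hQ]
  simp only [← (hint _).2, ← (hint2 _ _).2, ← intervalIntegral.integral_mul_const]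
  rw [← intervalIntegral.integral_finsetSum fun j _ => (hint j).1]
  have hii : ∀ i k, IntervalIntegrable (fun t => (1-t)*(s i-r k)^2/((1-t)*r k+t*s i) * c i k)
      MeasureTheory.volume 0 1 := fun i k => (hint2 i k).1.mul_const _
  have hi3 : ∀ i, IntervalIntegrable
      (fun t => ∑ k, (1-t)*(s i-r k)^2/((1-t)*r k+t*s i) * c i k)
      MeasureTheory.volume 0 1 := fun i => by
    simpa only [Finset.sum_fn] using IntervalIntegrable.sum Finset.univ fun k _ => hii i k
  have hi4 : IntervalIntegrable
      (fun t => ∑ i, ∑ k, (1-t)*(s i-r k)^2/((1-t)*r k+t*s i) * c i k)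
      MeasureTheory.volume 0 1 := by
    simpa only [Finset.sum_fn] using IntervalIntegrable.sum Finset.univ fun i _ => hi3 i
  have hi5 : IntervalIntegrable
      (fun t => ∑ j, (1-t)*(p j-q j)^2/((1-t)*q j+t*p j))
      MeasureTheory.volume 0 1 := by
    simpa only [Finset.sum_fn] using IntervalIntegrable.sum Finset.univ fun j _ => (hint j).1
  simp only [← intervalIntegral.integral_finsetSum fun k _ => hii _ k]
  rw [← intervalIntegral.integral_finsetSum fun i _ => hi3 i]
  refine intervalIntegral.integral_mono_on_of_le_Ioo zero_le_one hi5 hi4 fun t ht => ?_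
  have key := mul_le_mul_of_nonneg_left (aux_key hσp hρpd M hM ht.1 ht.2) (sub_pos.2 ht.2).le
  simp only [Finset.mul_sum] at key
  simpa only [mul_div_assoc, mul_assoc] using key
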